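/- Let K₁, …, K_m be finitely many nonempty compact connected subsets of the Euclidean plane, and for each i let Rᵢ = [xᵢ⁻,xᵢ⁺] × [yᵢ⁻,yᵢ⁺] be the axis-parallel bounding box of Kᵢ. Assume the boxes R₁, …, R_m are pairwise disjoint, and let s, t be points lying outside all of the boxes Rᵢ. Then for every continuous path γ : [0,1] → ℝ² from s to t whose image is disjoint from the union K₁ ∪ … ∪ K_m and whose length (total variation) is L, there exists a continuous path from s to t whose image is disjoint from the union of the interiors of the boxes R₁, …, R_m and whose length is at most √2 · L. -/

import Mathlib

/-- The closed axis-parallel rectangle `[xlo, xhi] × [ylo, yhi]` in the Euclidean plane. -/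
def closedBox (xlo xhi ylo yhi : ℝ) : Set (EuclideanSpace ℝ (Fin 2)) :=
  {p | xlo ≤ p 0 ∧ p 0 ≤ xhi ∧ ylo ≤ p 1 ∧ p 1 ≤ yhi}

open unitInterval in
lemma bb_crossing {A : Type*} [TopologicalSpace A] [PreconnectedSpace A] (k : A → ℂ)
    (hk : Continuous k) (g : I → ℂ) (hg : Continuous g) (hne : ∀ s a, g s ≠ k a)
    (h0 : ∀ a, (g 0).re ≤ (k a).re) (h1 : ∀ a, (k a).re ≤ (g 1).re) (b t : A)
    (hb : ∀ s, (k b).im ≤ (g s).im) (ht : ∀ s, (g s).im ≤ (k t).im) : False := by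
  have hslit : ∀ w : ℂ, w ≠ 0 → 0 ≤ w.re → w ∈ Complex.slitPlane := by
    intro w hw hre
    rcases hre.lt_or_eq with h | h
    · exact Or.inl h
    · right
      intro him
      exact hw (Complex.ext h.symm him)
  let H : C(I × A, {z : ℂ // z ≠ 0}) :=
    ⟨fun x => ⟨g x.1 - k x.2, sub_ne_zero.2 (hne _ _)⟩, by fun_prop⟩
  have hs0 : ∀ a, k a - g 0 ∈ Complex.slitPlane := fun a =>
    hslit _ (sub_ne_zero.2 (hne 0 a).symm) (by simpa using h0 a)
  have hs1 : ∀ a, g 1 - k a ∈ Complex.slitPlane := fun a =>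
    hslit _ (sub_ne_zero.2 (hne 1 a)) (by simpa using h1 a)
  let f : C(A, ℂ) := ⟨fun a => Complex.log (k a - g 0) + Real.pi * Complex.I, by
    refine Continuous.add ?_ continuous_const
    exact Continuous.clog (by fun_prop) hs0⟩
  have H0 : ∀ a, H (0, a) = (⟨_, (f a).exp_ne_zero⟩ : {z : ℂ // z ≠ 0}) := by
    intro a
    apply Subtype.ext
    change g 0 - k a = Complex.exp (Complex.log (k a - g 0) + Real.pi * Complex.I)
    rw [Complex.exp_add, Complex.exp_log (sub_ne_zero.2 (hne 0 a).symm), Complex.exp_pi_mul_I]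
    ring
  let Θ := Complex.isCoveringMap_exp.liftHomotopy H f H0
  have hΘ0 : ∀ a, Θ (0, a) = f a := Complex.isCoveringMap_exp.liftHomotopy_zero H f H0
  have hΘ : ∀ s a, Complex.exp (Θ (s, a)) = g s - k a := by
    intro s a
    have := congrFun (Complex.isCoveringMap_exp.liftHomotopy_lifts H f H0) (s, a)
    exact congrArg Subtype.val this
  have hΘc : Continuous Θ := Θ.continuous
  have him : ∀ s a, Real.exp (Θ (s, a)).re * Real.sin (Θ (s, a)).im = (g s).im - (k a).im := by
    intro s a
    rw [← Complex.exp_im, hΘ, Complex.sub_im]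
  have hf : ∀ a, (f a).im = Complex.arg (k a - g 0) + Real.pi := by
    intro a
    simp [f, Complex.log_im]
  have harg0 : ∀ a, |Complex.arg (k a - g 0)| ≤ Real.pi / 2 := fun a =>
    Complex.abs_arg_le_pi_div_two_iff.2 (by simpa using h0 a)
  have harg1 : ∀ a, |Complex.arg (g 1 - k a)| ≤ Real.pi / 2 := fun a =>
    Complex.abs_arg_le_pi_div_two_iff.2 (by simpa using h1 a)
  let D : A → ℝ := fun a => (Θ (1, a)).im - Complex.arg (g 1 - k a)
  have hD : ∀ a, ∃ n : ℤ, D a = n * (2 * Real.pi) := by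
    intro a
    have : Complex.exp (Θ (1, a) - Complex.log (g 1 - k a)) = 1 := by
      rw [Complex.exp_sub, hΘ, Complex.exp_log (sub_ne_zero.2 (hne 1 a)),
        div_self (sub_ne_zero.2 (hne 1 a))]
    obtain ⟨n, hn⟩ := Complex.exp_eq_one_iff.1 this
    refine ⟨n, ?_⟩
    have := congrArg Complex.im hn
    simpa [Complex.log_im, D] using this
  have hDc : Continuous D := by
    have h2 : Continuous fun a => (Complex.log (g 1 - k a)).im :=
      Complex.continuous_im.comp (Continuous.clog (by fun_prop) hs1)
    simp only [Complex.log_im] at h2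
    exact Continuous.sub (by fun_prop) h2
  have hpi := Real.pi_pos
  have hbF : (Θ (1, b)).im < 3 * Real.pi / 2 := by
    by_contra hcon
    push Not at hcon
    have e : (Θ (0, b)).im ≤ 3 * Real.pi / 2 := by
      rw [hΘ0, hf]
      have := (abs_le.1 (harg0 b)).2
      linarith
    obtain ⟨s, hs⟩ := mem_range_of_exists_le_of_exists_ge
      (f := fun s : I => (Θ (s, b)).im) (by fun_prop) ⟨0, e⟩ ⟨1, hcon⟩
    have h3 := him s b
    simp only at hs
    rw [hs, show 3 * Real.pi / 2 = Real.pi / 2 + Real.pi by ring, Real.sin_add_pi,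
      Real.sin_pi_div_two] at h3
    have := hb s
    have := Real.exp_pos (Θ (s, b)).re
    linarith
  have htF : Real.pi / 2 < (Θ (1, t)).im := by
    by_contra hcon
    push Not at hcon
    have e : Real.pi / 2 ≤ (Θ (0, t)).im := by
      rw [hΘ0, hf]
      have := (abs_le.1 (harg0 t)).1
      linarith
    obtain ⟨s, hs⟩ := mem_range_of_exists_le_of_exists_ge
      (f := fun s : I => (Θ (s, t)).im) (by fun_prop) ⟨1, hcon⟩ ⟨0, e⟩
    have h3 := him s t
    simp only at hs
    rw [hs, Real.sin_pi_div_two] at h3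
    have := ht s
    have := Real.exp_pos (Θ (s, t)).re
    linarith
  have hDb : D b ≤ Real.pi := by
    obtain ⟨n, hn⟩ := hD b
    have h3 : D b < 2 * Real.pi := by
      have := (abs_le.1 (harg1 b)).1
      simp only [D]; linarith
    rw [hn] at h3
    have h4 : (n : ℝ) < 1 := by nlinarith
    have h5 : n ≤ 0 := by
      have : n < 1 := by exact_mod_cast h4
      omega
    have h6 : (n : ℝ) ≤ 0 := by exact_mod_cast h5
    rw [hn]; nlinarith
  have hDt : Real.pi ≤ D t := by
    obtain ⟨n, hn⟩ := hD t
    have h3 : 0 < D t := by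
      have := (abs_le.1 (harg1 t)).2
      simp only [D]; linarith
    rw [hn] at h3
    have h4 : (0 : ℝ) < n := by
      by_contra h; push Not at h; nlinarith
    have h5 : 1 ≤ n := by
      have : 0 < n := by exact_mod_cast h4
      omega
    have h6 : (1 : ℝ) ≤ n := by exact_mod_cast h5
    rw [hn]; nlinarith
  obtain ⟨a, ha⟩ := mem_range_of_exists_le_of_exists_ge hDc ⟨b, hDb⟩ ⟨t, hDt⟩
  obtain ⟨n, hn⟩ := hD a
  rw [ha] at hn
  have h4 : (2 * n : ℝ) = 1 := by
    have : Real.pi * (2 * n - 1) = 0 := by linarith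
    rcases mul_eq_zero.1 this with h | h
    · exact absurd h hpi.ne'
    · linarith
  have h5 : 2 * n = 1 := by exact_mod_cast h4
  omega

open Set ENNReal in
lemma bb_cross (K : Set (EuclideanSpace ℝ (Fin 2))) (hK : IsConnected K)
    (γ : ℝ → EuclideanSpace ℝ (Fin 2)) (a b : ℝ) (hab : a ≤ b)
    (hγ : ContinuousOn γ (Icc a b)) (hav : ∀ τ ∈ Icc a b, γ τ ∉ K) (i j : Fin 2) (hij : i ≠ j)
    (e : ℝ) (he : e ≠ 0) (hp : ∀ k ∈ K, e * γ a i ≤ e * k i) (hq : ∀ k ∈ K, e * k i ≤ e * γ b i)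
    (kb kt : EuclideanSpace ℝ (Fin 2)) (hkb : kb ∈ K) (hkt : kt ∈ K) :
    ∃ r ∈ Icc a b, γ r j < kb j ∨ kt j < γ r j := by
  by_contra hcon
  push Not at hcon
  have : PreconnectedSpace K := Subtype.preconnectedSpace hK.isPreconnected
  let φ : EuclideanSpace ℝ (Fin 2) → ℂ := fun p => ⟨e * p i, p j⟩
  have hφ : Continuous φ := by
    have : φ = fun p => ((e * p i : ℝ) : ℂ) + (p j : ℝ) * Complex.I := by
      funext p
      apply Complex.ext <;> simp [φ]
    rw [this]
    fun_prop
  have hinj : ∀ p q, φ p = φ q → p = q := by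
    intro p q h
    have h1 : e * p i = e * q i := congrArg Complex.re h
    have h2 : p j = q j := congrArg Complex.im h
    have h3 : p i = q i := mul_left_cancel₀ he h1
    ext l
    have : l = i ∨ l = j := by
      omega
    rcases this with rfl | rfl <;> assumption
  let ρ : unitInterval → ℝ := fun s => a + (b - a) * s
  have hρ : ∀ s, ρ s ∈ Icc a b := by
    intro s
    have h1 := s.2.1
    have h2 := s.2.2
    constructor <;> simp only [ρ] <;> nlinarith
  have hρc : Continuous ρ := by fun_prop
  refine bb_crossing (fun k : K => φ k) (by fun_prop) (fun s => φ (γ (ρ s)))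
    (hφ.comp (hγ.comp_continuous hρc hρ)) ?_ ?_ ?_ ⟨kb, hkb⟩ ⟨kt, hkt⟩ ?_ ?_
  · intro s k h
    have := hinj _ _ h
    exact hav _ (hρ s) (this ▸ k.2)
  · intro k
    simpa [φ, ρ] using hp k k.2
  · intro k
    simpa [φ, ρ] using hq k k.2
  · intro s
    exact (hcon _ (hρ s)).1
  · intro s
    exact (hcon _ (hρ s)).2

/-- Existence of a path of bounded length inside a set. -/
def BReach (G : Set (EuclideanSpace ℝ (Fin 2))) (p q : EuclideanSpace ℝ (Fin 2)) (l : ENNReal) :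
    Prop :=
  ∃ δ : ℝ → EuclideanSpace ℝ (Fin 2), ContinuousOn δ (Set.Icc 0 1) ∧ δ 0 = p ∧ δ 1 = q ∧
    (∀ τ ∈ Set.Icc (0 : ℝ) 1, δ τ ∈ G) ∧ eVariationOn δ (Set.Icc 0 1) ≤ l

open Set ENNReal

lemma BReach.mono {G G' : Set (EuclideanSpace ℝ (Fin 2))} {p q : EuclideanSpace ℝ (Fin 2)}
    {l l' : ENNReal} (h : BReach G p q l) (hG : G ⊆ G') (hl : l ≤ l') : BReach G' p q l' := by
  obtain ⟨δ, h1, h2, h3, h4, h5⟩ := h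
  exact ⟨δ, h1, h2, h3, fun τ hτ => hG (h4 τ hτ), h5.trans hl⟩

lemma BReach.of_path (G : Set (EuclideanSpace ℝ (Fin 2))) (γ : ℝ → EuclideanSpace ℝ (Fin 2))
    (a b : ℝ) (hab : a ≤ b) (hγ : ContinuousOn γ (Icc a b)) (hG : ∀ τ ∈ Icc a b, γ τ ∈ G) :
    BReach G (γ a) (γ b) (eVariationOn γ (Icc a b)) := by
  let ρ : ℝ → ℝ := fun s => a + (b - a) * s
  have hρ : MapsTo ρ (Icc 0 1) (Icc a b) := by
    rintro s ⟨h1, h2⟩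
    constructor <;> simp only [ρ] <;> nlinarith
  refine ⟨γ ∘ ρ, hγ.comp (by fun_prop) hρ, by simp [ρ], by simp [ρ], fun τ hτ => hG _ (hρ hτ),
    eVariationOn.comp_le_of_monotoneOn γ ρ ?_ hρ⟩
  intro x _ y _ hxy
  simp only [ρ]
  nlinarith

lemma BReach.trans {G : Set (EuclideanSpace ℝ (Fin 2))} {p q r : EuclideanSpace ℝ (Fin 2)}
    {l l' : ENNReal} (h : BReach G p q l) (h' : BReach G q r l') : BReach G p r (l + l') := by
  obtain ⟨δ, h1, h2, h3, h4, h5⟩ := h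
  obtain ⟨δ', h1', h2', h3', h4', h5'⟩ := h'
  let η : ℝ → EuclideanSpace ℝ (Fin 2) := fun t => if t ≤ 1 then δ t else δ' (t - 1)
  have e1 : EqOn η δ (Icc 0 1) := fun t ht => by simp [η, ht.2]
  have e2 : EqOn η (δ' ∘ fun t => t - 1) (Icc 1 2) := fun t ht => by
    rcases ht.1.eq_or_lt with h | h
    · subst h; simp [η, h3, h2']
    · simp [η, not_le.2 h]
  have hm : MapsTo (fun t : ℝ => t - 1) (Icc 1 2) (Icc 0 1) := by
    rintro t ⟨ha, hb⟩; constructor <;> linarith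
  have c1 : ContinuousOn η (Icc 0 1) := h1.congr e1
  have c2 : ContinuousOn η (Icc 1 2) := (h1'.comp (by fun_prop) hm).congr e2
  have hu : Icc (0 : ℝ) 1 ∪ Icc 1 2 = Icc 0 2 := Icc_union_Icc_eq_Icc (by norm_num) (by norm_num)
  have c : ContinuousOn η (Icc 0 2) := by
    rw [← hu]
    exact c1.union_of_isClosed c2 isClosed_Icc isClosed_Icc
  have key := BReach.of_path G η 0 2 (by norm_num) c (by
    rw [← hu]
    rintro τ (hτ | hτ)
    · rw [e1 hτ]; exact h4 _ hτ
    · rw [e2 hτ]; exact h4' _ (hm hτ))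
  have k0 : η 0 = p := by simp [η, h2]
  have k2 : η 2 = r := by
    have : (2 : ℝ) - 1 = 1 := by norm_num
    simp [η, this, h3']
  rw [k0, k2] at key
  refine key.mono le_rfl ?_
  have := eVariationOn.Icc_add_Icc η (s := univ) (a := 0) (b := 1) (c := 2) (by norm_num)
    (by norm_num) (mem_univ _)
  simp only [univ_inter] at this
  rw [← this]
  refine add_le_add ?_ ?_
  · rw [eVariationOn.congr e1]; exact h5
  · rw [eVariationOn.congr e2]
    refine (eVariationOn.comp_le_of_monotoneOn δ' _ ?_ hm).trans h5'
    intro x _ y _ hxy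
    simpa using hxy

/-- Taxicab distance. -/
noncomputable def bbL (p q : EuclideanSpace ℝ (Fin 2)) : ℝ := |p 0 - q 0| + |p 1 - q 1|

lemma bb_dist_le (p q : EuclideanSpace ℝ (Fin 2)) : dist p q ≤ bbL p q := by
  rw [EuclideanSpace.dist_eq, Fin.sum_univ_two, bbL, Real.dist_eq, Real.dist_eq]
  apply Real.sqrt_le_iff.2
  have := abs_nonneg (p 0 - q 0)
  have := abs_nonneg (p 1 - q 1)
  constructor
  · positivity
  · nlinarith

lemma bb_le_dist (p q : EuclideanSpace ℝ (Fin 2)) : bbL p q ≤ √2 * dist p q := by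
  rw [EuclideanSpace.dist_eq, Fin.sum_univ_two, bbL, Real.dist_eq, Real.dist_eq,
    ← Real.sqrt_mul (by norm_num)]
  apply Real.le_sqrt_of_sq_le
  nlinarith [sq_nonneg (|p 0 - q 0| - |p 1 - q 1|)]

lemma BReach.seg (G : Set (EuclideanSpace ℝ (Fin 2))) (p q : EuclideanSpace ℝ (Fin 2))
    (hG : ∀ τ ∈ Icc (0 : ℝ) 1, AffineMap.lineMap p q τ ∈ G) :
    BReach G p q (ENNReal.ofReal (bbL p q)) := by
  refine ⟨fun τ => AffineMap.lineMap p q τ, ?_, by simp, by simp, hG, ?_⟩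
  · exact AffineMap.lineMap_continuous.continuousOn
  · have hl : LipschitzWith (nndist p q) (fun τ : ℝ => AffineMap.lineMap p q τ) :=
      lipschitzWith_lineMap p q
    have h1 := (hl.lipschitzOnWith (s := univ)).comp_eVariationOn_le (g := fun t : ℝ => t)
      (s := Icc 0 1) (mapsTo_univ _ _)
    have h2 := (monotone_id.monotoneOn (Icc (0 : ℝ) 1)).eVariationOn_eq
      (a := 0) (b := 1) (by simp) (by simp)
    simp only [inter_self, id, sub_zero, ofReal_one] at h2
    refine h1.trans ?_
    refine (mul_le_mul_right h2.le _).trans ?_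
    rw [mul_one, ← edist_nndist, edist_dist]
    exact ofReal_le_ofReal (bb_dist_le p q)

lemma bb_interior (xlo xhi ylo yhi : ℝ) (z : EuclideanSpace ℝ (Fin 2)) :
    z ∈ interior (closedBox xlo xhi ylo yhi) ↔ xlo < z 0 ∧ z 0 < xhi ∧ ylo < z 1 ∧ z 1 < yhi := by
  have hop : ∀ i : Fin 2, IsOpenMap (EuclideanSpace.proj i : EuclideanSpace ℝ (Fin 2) →L[ℝ] ℝ) := by
    intro i
    apply ContinuousLinearMap.isOpenMap
    intro x
    exact ⟨EuclideanSpace.single i x, by simp⟩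
  have : closedBox xlo xhi ylo yhi = (EuclideanSpace.proj (0 : Fin 2) : EuclideanSpace ℝ (Fin 2) →L[ℝ] ℝ) ⁻¹'
      (Icc xlo xhi) ∩ (EuclideanSpace.proj (1 : Fin 2) : EuclideanSpace ℝ (Fin 2) →L[ℝ] ℝ) ⁻¹' (Icc ylo yhi) := by
    ext p
    simp [closedBox, and_assoc]
  rw [this, interior_inter,
    ← (hop 0).preimage_interior_eq_interior_preimage (ContinuousLinearMap.continuous _),
    ← (hop 1).preimage_interior_eq_interior_preimage (ContinuousLinearMap.continuous _)]
  simp [and_assoc]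

/-- The boundary of the box. -/
def bbF (xlo xhi ylo yhi : ℝ) : Set (EuclideanSpace ℝ (Fin 2)) :=
  {z | z ∈ closedBox xlo xhi ylo yhi ∧ (z 0 = xlo ∨ z 0 = xhi ∨ z 1 = ylo ∨ z 1 = yhi)}

lemma bb_conv {a b x y τ : ℝ} (h : τ ∈ Icc (0 : ℝ) 1) (hx : x ∈ Icc a b) (hy : y ∈ Icc a b) :
    τ * (y - x) + x ∈ Icc a b := by
  obtain ⟨h0, h1⟩ := h
  obtain ⟨hx0, hx1⟩ := hx
  obtain ⟨hy0, hy1⟩ := hy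
  constructor <;> nlinarith

lemma bb_line (p q : EuclideanSpace ℝ (Fin 2)) (τ : ℝ) (i : Fin 2) :
    (AffineMap.lineMap p q τ : EuclideanSpace ℝ (Fin 2)) i = τ * (q i - p i) + p i := by
  simp [AffineMap.lineMap_apply]

lemma bb_line_mem {xlo xhi ylo yhi : ℝ} {p q : EuclideanSpace ℝ (Fin 2)}
    (hp : p ∈ closedBox xlo xhi ylo yhi) (hq : q ∈ closedBox xlo xhi ylo yhi)
    {τ : ℝ} (h : τ ∈ Icc (0 : ℝ) 1) : AffineMap.lineMap p q τ ∈ closedBox xlo xhi ylo yhi := by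
  obtain ⟨a, b, c, d⟩ := hp
  obtain ⟨a', b', c', d'⟩ := hq
  have h0 := bb_conv h ⟨a, b⟩ ⟨a', b'⟩
  have h1 := bb_conv h ⟨c, d⟩ ⟨c', d'⟩
  refine ⟨?_, ?_, ?_, ?_⟩ <;> rw [bb_line]
  exacts [h0.1, h0.2, h1.1, h1.2]

lemma bb_segV {xlo xhi ylo yhi : ℝ} {p q : EuclideanSpace ℝ (Fin 2)}
    (hp : p ∈ closedBox xlo xhi ylo yhi) (hq : q ∈ closedBox xlo xhi ylo yhi)
    (h : p 0 = q 0) (hs : p 0 = xlo ∨ p 0 = xhi) :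
    BReach (bbF xlo xhi ylo yhi) p q (ENNReal.ofReal (bbL p q)) := by
  refine BReach.seg _ _ _ fun τ hτ => ⟨bb_line_mem hp hq hτ, ?_⟩
  simp only [bb_line, ← h, sub_self, mul_zero, zero_add]
  tauto

lemma bb_segH {xlo xhi ylo yhi : ℝ} {p q : EuclideanSpace ℝ (Fin 2)}
    (hp : p ∈ closedBox xlo xhi ylo yhi) (hq : q ∈ closedBox xlo xhi ylo yhi)
    (h : p 1 = q 1) (hs : p 1 = ylo ∨ p 1 = yhi) :
    BReach (bbF xlo xhi ylo yhi) p q (ENNReal.ofReal (bbL p q)) := by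
  refine BReach.seg _ _ _ fun τ hτ => ⟨bb_line_mem hp hq hτ, ?_⟩
  simp only [bb_line, ← h, sub_self, mul_zero, zero_add]
  tauto

lemma bbL_nonneg (p q : EuclideanSpace ℝ (Fin 2)) : 0 ≤ bbL p q := by
  unfold bbL; positivity

lemma bb_var (γ : ℝ → EuclideanSpace ℝ (Fin 2)) (a b r : ℝ) (hr : r ∈ Icc a b) :
    ENNReal.ofReal (bbL (γ a) (γ r) + bbL (γ r) (γ b)) ≤
      ENNReal.ofReal (√2) * eVariationOn γ (Icc a b) := by
  have := eVariationOn.Icc_add_Icc γ (s := univ) hr.1 hr.2 (mem_univ _)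
  simp only [univ_inter] at this
  rw [← this, mul_add, ENNReal.ofReal_add (bbL_nonneg _ _) (bbL_nonneg _ _)]
  have key : ∀ c d : ℝ, c ≤ d → ENNReal.ofReal (bbL (γ c) (γ d)) ≤
      ENNReal.ofReal (√2) * eVariationOn γ (Icc c d) := by
    intro c d hcd
    refine (ofReal_le_ofReal (bb_le_dist _ _)).trans ?_
    rw [ofReal_mul (Real.sqrt_nonneg 2), ← edist_dist]
    exact mul_le_mul_right (eVariationOn.edist_le γ (left_mem_Icc.2 hcd) (right_mem_Icc.2 hcd)) _
  exact add_le_add (key _ _ hr.1) (key _ _ hr.2)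

lemma bb_local (K : Set (EuclideanSpace ℝ (Fin 2))) (hK : IsConnected K) (xlo xhi ylo yhi : ℝ)
    (hbox : ∀ k ∈ K, k ∈ closedBox xlo xhi ylo yhi)
    (hx0 : ∃ k ∈ K, k 0 = xlo) (hx1 : ∃ k ∈ K, k 0 = xhi)
    (hy0 : ∃ k ∈ K, k 1 = ylo) (hy1 : ∃ k ∈ K, k 1 = yhi)
    (γ : ℝ → EuclideanSpace ℝ (Fin 2)) (a b : ℝ) (hab : a ≤ b)
    (hγ : ContinuousOn γ (Icc a b)) (hav : ∀ τ ∈ Icc a b, γ τ ∉ K)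
    (hp : γ a ∈ bbF xlo xhi ylo yhi) (hq : γ b ∈ bbF xlo xhi ylo yhi) :
    BReach (bbF xlo xhi ylo yhi) (γ a) (γ b)
      (ENNReal.ofReal (√2) * eVariationOn γ (Icc a b)) := by
  have hvar := bb_var γ a b
  have hcross := bb_cross K hK γ a b hab hγ hav
  obtain ⟨kx0, hkx0, ex0⟩ := hx0
  obtain ⟨kx1, hkx1, ex1⟩ := hx1
  obtain ⟨ky0, hky0, ey0⟩ := hy0
  obtain ⟨ky1, hky1, ey1⟩ := hy1
  obtain ⟨hpb, hps⟩ := hp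
  obtain ⟨hqb, hqs⟩ := hq
  have hva := hvar a ⟨le_rfl, hab⟩
  generalize γ a = p at *
  generalize γ b = q at *
  have hpb' := hpb
  have hqb' := hqb
  obtain ⟨p1, p2, p3, p4⟩ := hpb'
  obtain ⟨q1, q2, q3, q4⟩ := hqb'
  have hps : (p 0 = xlo ∨ p 0 = xhi) ∨ (p 1 = ylo ∨ p 1 = yhi) := by tauto
  have hqs : (q 0 = xlo ∨ q 0 = xhi) ∨ (q 1 = ylo ∨ q 1 = yhi) := by tauto
  rcases hps with hps | hps <;> rcases hqs with hqs | hqs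
  · by_cases h0 : p 0 = q 0
    · refine (bb_segV hpb hqb h0 hps).mono le_rfl (le_trans (ofReal_le_ofReal ?_) hva)
      simp [bbL]
    have : ∃ r ∈ Icc a b, γ r 1 < ky0 1 ∨ ky1 1 < γ r 1 := by
      rcases hps with h1 | h1 <;> rcases hqs with h2 | h2
      · exact absurd (h1.trans h2.symm) h0
      · refine hcross 0 1 (by decide) 1 one_ne_zero ?_ ?_ ky0 ky1 hky0 hky1
        · intro k hk; have := hbox k hk; rw [h1, one_mul, one_mul]; exact this.1
        · intro k hk; have := hbox k hk; rw [h2, one_mul, one_mul]; exact this.2.1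
      · refine hcross 0 1 (by decide) (-1) (by norm_num) ?_ ?_ ky0 ky1 hky0 hky1
        · intro k hk; have := hbox k hk; rw [h1]; linarith [this.2.1]
        · intro k hk; have := hbox k hk; rw [h2]; linarith [this.1]
      · exact absurd (h1.trans h2.symm) h0
    obtain ⟨r, hr, hrr⟩ := this
    rw [ey0, ey1] at hrr
    obtain ⟨Y, hY, hYb, hle⟩ : ∃ Y, (Y = ylo ∨ Y = yhi) ∧ Y ∈ Icc ylo yhi ∧
        |p 1 - Y| + |Y - q 1| ≤ |p 1 - γ r 1| + |γ r 1 - q 1| := by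
      rcases hrr with h | h
      · refine ⟨ylo, Or.inl rfl, ⟨le_rfl, by linarith⟩, ?_⟩
        rw [abs_of_nonneg (by linarith), abs_of_nonpos (by linarith),
          abs_of_nonneg (by linarith), abs_of_nonpos (by linarith)]
        linarith
      · refine ⟨yhi, Or.inr rfl, ⟨by linarith, le_rfl⟩, ?_⟩
        rw [abs_of_nonpos (by linarith), abs_of_nonneg (by linarith),
          abs_of_nonpos (by linarith), abs_of_nonneg (by linarith)]
        linarith
    have m1 : !₂[p 0, Y] ∈ closedBox xlo xhi ylo yhi := ⟨p1, p2, hYb.1, hYb.2⟩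
    have m2 : !₂[q 0, Y] ∈ closedBox xlo xhi ylo yhi := ⟨q1, q2, hYb.1, hYb.2⟩
    have s1 := bb_segV hpb m1 (by simp) hps
    have s2 := bb_segH m1 m2 (by simp) (by simpa using hY)
    have s3 := bb_segV m2 hqb (by simp) (by simpa using hqs)
    refine ((s1.trans s2).trans s3).mono le_rfl (le_trans ?_ (hvar r hr))
    rw [← ofReal_add (bbL_nonneg _ _) (bbL_nonneg _ _),
      ← ofReal_add (add_nonneg (bbL_nonneg _ _) (bbL_nonneg _ _)) (bbL_nonneg _ _)]
    apply ofReal_le_ofReal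
    have := abs_sub_le (p 0) (γ r 0) (q 0)
    simp [bbL]
    linarith
  · have m1 : !₂[p 0, q 1] ∈ closedBox xlo xhi ylo yhi := ⟨p1, p2, q3, q4⟩
    have s1 := bb_segV hpb m1 (by simp) hps
    have s2 := bb_segH m1 hqb (by simp) (by simpa using hqs)
    refine (s1.trans s2).mono le_rfl (le_trans ?_ hva)
    rw [← ofReal_add (bbL_nonneg _ _) (bbL_nonneg _ _)]
    apply ofReal_le_ofReal
    simp [bbL]
    linarith
  · have m1 : !₂[q 0, p 1] ∈ closedBox xlo xhi ylo yhi := ⟨q1, q2, p3, p4⟩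
    have s1 := bb_segH hpb m1 (by simp) hps
    have s2 := bb_segV m1 hqb (by simp) (by simpa using hqs)
    refine (s1.trans s2).mono le_rfl (le_trans ?_ hva)
    rw [← ofReal_add (bbL_nonneg _ _) (bbL_nonneg _ _)]
    apply ofReal_le_ofReal
    simp [bbL]
  · by_cases h0 : p 1 = q 1
    · refine (bb_segH hpb hqb h0 hps).mono le_rfl (le_trans (ofReal_le_ofReal ?_) hva)
      simp [bbL]
    have : ∃ r ∈ Icc a b, γ r 0 < kx0 0 ∨ kx1 0 < γ r 0 := by
      rcases hps with h1 | h1 <;> rcases hqs with h2 | h2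
      · exact absurd (h1.trans h2.symm) h0
      · refine hcross 1 0 (by decide) 1 one_ne_zero ?_ ?_ kx0 kx1 hkx0 hkx1
        · intro k hk; have := hbox k hk; rw [h1, one_mul, one_mul]; exact this.2.2.1
        · intro k hk; have := hbox k hk; rw [h2, one_mul, one_mul]; exact this.2.2.2
      · refine hcross 1 0 (by decide) (-1) (by norm_num) ?_ ?_ kx0 kx1 hkx0 hkx1
        · intro k hk; have := hbox k hk; rw [h1]; linarith [this.2.2.2]
        · intro k hk; have := hbox k hk; rw [h2]; linarith [this.2.2.1]
      · exact absurd (h1.trans h2.symm) h0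
    obtain ⟨r, hr, hrr⟩ := this
    rw [ex0, ex1] at hrr
    obtain ⟨X, hX, hXb, hle⟩ : ∃ X, (X = xlo ∨ X = xhi) ∧ X ∈ Icc xlo xhi ∧
        |p 0 - X| + |X - q 0| ≤ |p 0 - γ r 0| + |γ r 0 - q 0| := by
      rcases hrr with h | h
      · refine ⟨xlo, Or.inl rfl, ⟨le_rfl, by linarith⟩, ?_⟩
        rw [abs_of_nonneg (by linarith), abs_of_nonpos (by linarith),
          abs_of_nonneg (by linarith), abs_of_nonpos (by linarith)]
        linarith
      · refine ⟨xhi, Or.inr rfl, ⟨by linarith, le_rfl⟩, ?_⟩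
        rw [abs_of_nonpos (by linarith), abs_of_nonneg (by linarith),
          abs_of_nonpos (by linarith), abs_of_nonneg (by linarith)]
        linarith
    have m1 : !₂[X, p 1] ∈ closedBox xlo xhi ylo yhi := ⟨hXb.1, hXb.2, p3, p4⟩
    have m2 : !₂[X, q 1] ∈ closedBox xlo xhi ylo yhi := ⟨hXb.1, hXb.2, q3, q4⟩
    have s1 := bb_segH hpb m1 (by simp) hps
    have s2 := bb_segV m1 m2 (by simp) (by simpa using hX)
    have s3 := bb_segH m2 hqb (by simp) (by simpa using hqs)
    refine ((s1.trans s2).trans s3).mono le_rfl (le_trans ?_ (hvar r hr))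
    rw [← ofReal_add (bbL_nonneg _ _) (bbL_nonneg _ _),
      ← ofReal_add (add_nonneg (bbL_nonneg _ _) (bbL_nonneg _ _)) (bbL_nonneg _ _)]
    apply ofReal_le_ofReal
    have := abs_sub_le (p 1) (γ r 1) (q 1)
    simp [bbL]
    linarith

lemma bb_induct {m : ℕ} (R : Fin m → Set (EuclideanSpace ℝ (Fin 2)))
    (hcl : ∀ i, IsClosed (R i)) (hdisj : Pairwise fun i j => Disjoint (R i) (R j))
    (γ : ℝ → EuclideanSpace ℝ (Fin 2)) (hγ : ContinuousOn γ (Icc 0 1))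
    (hloc : ∀ i, ∀ a b : ℝ, 0 ≤ a → a ≤ b → b ≤ 1 → γ a ∈ R i \ interior (R i) →
      γ b ∈ R i \ interior (R i) → BReach (R i \ interior (R i)) (γ a) (γ b)
      (ENNReal.ofReal (√2) * eVariationOn γ (Icc a b))) (S : Finset (Fin m)) :
    ∀ a b : ℝ, 0 ≤ a → a ≤ b → b ≤ 1 → (∀ i, γ a ∉ interior (R i)) →
      (∀ i, γ b ∉ interior (R i)) →
      (∀ τ ∈ Icc a b, ∀ i, γ τ ∈ interior (R i) → i ∈ S) →
      BReach {z | ∀ i, z ∉ interior (R i)} (γ a) (γ b)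
        (ENNReal.ofReal (√2) * eVariationOn γ (Icc a b)) := by
  induction S using Finset.induction_on with
  | empty =>
    intro a b h0 hab h1 ha hb hS
    refine (BReach.of_path _ γ a b hab (hγ.mono (Icc_subset_Icc h0 h1)) ?_).mono le_rfl ?_
    · intro τ hτ i hi
      simpa using hS τ hτ i hi
    · refine le_mul_of_one_le_left zero_le ?_
      rw [← ofReal_one]
      apply ofReal_le_ofReal
      rw [Real.one_le_sqrt]
      norm_num
  | insert i S hiS ih =>
    intro a b h0 hab h1 ha hb hS
    have hγab : ContinuousOn γ (Icc a b) := hγ.mono (Icc_subset_Icc h0 h1)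
    by_cases hmeet : (Icc a b ∩ γ ⁻¹' R i).Nonempty
    swap
    · refine ih a b h0 hab h1 ha hb fun τ hτ j hj => ?_
      rcases Finset.mem_insert.1 (hS τ hτ j hj) with h | h
      · subst h
        exact absurd ⟨τ, hτ, (interior_subset hj : γ τ ∈ R _)⟩ hmeet
      · exact h
    have hcpt : IsCompact (Icc a b ∩ γ ⁻¹' R i) :=
      isCompact_Icc.of_isClosed_subset (hγab.preimage_isClosed_of_isClosed isClosed_Icc (hcl i))
        inter_subset_left
    obtain ⟨c, ⟨hc, hcR⟩, hcm⟩ := hcpt.exists_isLeast hmeet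
    obtain ⟨d, ⟨hd, hdR⟩, hdm⟩ := hcpt.exists_isGreatest hmeet
    have hcd : c ≤ d := hcm ⟨hd, hdR⟩
    have hclosed : IsClosed (Icc a b ∩ γ ⁻¹' (interior (R i))ᶜ) :=
      hγab.preimage_isClosed_of_isClosed isClosed_Icc isOpen_interior.isClosed_compl
    have hcI : γ c ∉ interior (R i) := by
      rcases hc.1.eq_or_lt with h | h
      · rw [← h]; exact ha i
      · have hsub : Ico a c ⊆ Icc a b ∩ γ ⁻¹' (interior (R i))ᶜ := by
          intro τ hτ
          have hτ' : τ ∈ Icc a b := ⟨hτ.1, hτ.2.le.trans hc.2⟩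
          exact ⟨hτ', fun hh => absurd (hcm ⟨hτ', (interior_subset hh : γ τ ∈ R _)⟩) (not_le.2 hτ.2)⟩
        have := closure_minimal hsub hclosed
        rw [closure_Ico h.ne] at this
        exact (this (right_mem_Icc.2 h.le)).2
    have hdI : γ d ∉ interior (R i) := by
      rcases hd.2.eq_or_lt with h | h
      · rw [h]; exact hb i
      · have hsub : Ioc d b ⊆ Icc a b ∩ γ ⁻¹' (interior (R i))ᶜ := by
          intro τ hτ
          have hτ' : τ ∈ Icc a b := ⟨hd.1.trans hτ.1.le, hτ.2⟩
          exact ⟨hτ', fun hh => absurd (hdm ⟨hτ', (interior_subset hh : γ τ ∈ R _)⟩) (not_le.2 hτ.1)⟩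
        have := closure_minimal hsub hclosed
        rw [closure_Ioc h.ne] at this
        exact (this (left_mem_Icc.2 h.le)).2
    have hout : ∀ z ∈ R i \ interior (R i), ∀ j, z ∉ interior (R j) := by
      rintro z ⟨hz, hz'⟩ j hj
      by_cases hij : i = j
      · subst hij; exact hz' hj
      · exact disjoint_left.1 (hdisj hij) hz (interior_subset hj)
    have r1 := ih a c h0 hc.1 (hc.2.trans h1) ha (hout _ ⟨hcR, hcI⟩) (by
      intro τ hτ j hj
      have hτ' : τ ∈ Icc a b := ⟨hτ.1, hτ.2.trans hc.2⟩
      rcases Finset.mem_insert.1 (hS τ hτ' j hj) with h | h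
      · subst h
        have : τ = c := le_antisymm hτ.2 (hcm ⟨hτ', (interior_subset hj : γ τ ∈ R _)⟩)
        subst this
        exact absurd hj hcI
      · exact h)
    have r3 := ih d b (h0.trans hd.1) hd.2 h1 (hout _ ⟨hdR, hdI⟩) hb (by
      intro τ hτ j hj
      have hτ' : τ ∈ Icc a b := ⟨hd.1.trans hτ.1, hτ.2⟩
      rcases Finset.mem_insert.1 (hS τ hτ' j hj) with h | h
      · subst h
        have : τ = d := le_antisymm (hdm ⟨hτ', (interior_subset hj : γ τ ∈ R _)⟩) hτ.1
        subst this
        exact absurd hj hdI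
      · exact h)
    have r2 := (hloc i c d (h0.trans hc.1) hcd (hd.2.trans h1) ⟨hcR, hcI⟩ ⟨hdR, hdI⟩).mono
      (G' := {z | ∀ i, z ∉ interior (R i)}) hout le_rfl
    refine ((r1.trans r2).trans r3).mono le_rfl ?_
    rw [← mul_add, ← mul_add]
    have e1 := eVariationOn.Icc_add_Icc γ (s := univ) hc.1 hcd (mem_univ _)
    have e2 := eVariationOn.Icc_add_Icc γ (s := univ) (hc.1.trans hcd) hd.2 (mem_univ _)
    simp only [univ_inter] at e1 e2
    rw [e1, e2]

/-- For obstacles with pairwise disjoint axis-parallel bounding boxes, routing around the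
bounding boxes is `√2`-competitive: given a continuous path of length (total variation) `L`
from `s` to `t` avoiding all obstacles, where `s` and `t` lie outside all bounding boxes,
there is a continuous path from `s` to `t` avoiding the interiors of all bounding boxes
whose length is at most `√2 * L`. -/
theorem bbox_routing_sqrt_two_competitive
    (m : ℕ) (K : Fin m → Set (EuclideanSpace ℝ (Fin 2)))
    (hne : ∀ i, (K i).Nonempty) (hcpt : ∀ i, IsCompact (K i))
    (hconn : ∀ i, IsConnected (K i))
    (xlo xhi ylo yhi : Fin m → ℝ)
    (hxlo : ∀ i, xlo i = sInf ((fun p : EuclideanSpace ℝ (Fin 2) => p 0) '' K i))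
    (hxhi : ∀ i, xhi i = sSup ((fun p : EuclideanSpace ℝ (Fin 2) => p 0) '' K i))
    (hylo : ∀ i, ylo i = sInf ((fun p : EuclideanSpace ℝ (Fin 2) => p 1) '' K i))
    (hyhi : ∀ i, yhi i = sSup ((fun p : EuclideanSpace ℝ (Fin 2) => p 1) '' K i))
    (R : Fin m → Set (EuclideanSpace ℝ (Fin 2)))
    (hR : ∀ i, R i = closedBox (xlo i) (xhi i) (ylo i) (yhi i))
    (hdisjR : Pairwise fun i j => Disjoint (R i) (R j))
    (s t : EuclideanSpace ℝ (Fin 2))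
    (hs : ∀ i, s ∉ R i) (ht : ∀ i, t ∉ R i)
    (γ : ℝ → EuclideanSpace ℝ (Fin 2))
    (hγ : ContinuousOn γ (Set.Icc 0 1)) (hγ0 : γ 0 = s) (hγ1 : γ 1 = t)
    (havoid : ∀ τ ∈ Set.Icc (0 : ℝ) 1, ∀ i, γ τ ∉ K i)
    (L : ℝ) (hL : eVariationOn γ (Set.Icc 0 1) = ENNReal.ofReal L) :
    ∃ δ : ℝ → EuclideanSpace ℝ (Fin 2),
      ContinuousOn δ (Set.Icc 0 1) ∧ δ 0 = s ∧ δ 1 = t ∧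
      (∀ τ ∈ Set.Icc (0 : ℝ) 1, ∀ i, δ τ ∉ interior (R i)) ∧
      eVariationOn δ (Set.Icc 0 1) ≤ ENNReal.ofReal (Real.sqrt 2 * L) := by
  have hc : ∀ j : Fin 2, Continuous fun p : EuclideanSpace ℝ (Fin 2) => p j := fun j => by fun_prop
  have himg : ∀ i j, IsCompact ((fun p : EuclideanSpace ℝ (Fin 2) => p j) '' K i) :=
    fun i j => (hcpt i).image (hc j)
  have hbox : ∀ i, ∀ k ∈ K i, k ∈ closedBox (xlo i) (xhi i) (ylo i) (yhi i) := by
    intro i k hk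
    refine ⟨?_, ?_, ?_, ?_⟩
    · rw [hxlo]; exact csInf_le (himg i 0).bddBelow ⟨k, hk, rfl⟩
    · rw [hxhi]; exact le_csSup (himg i 0).bddAbove ⟨k, hk, rfl⟩
    · rw [hylo]; exact csInf_le (himg i 1).bddBelow ⟨k, hk, rfl⟩
    · rw [hyhi]; exact le_csSup (himg i 1).bddAbove ⟨k, hk, rfl⟩
  have hF : ∀ i, R i \ interior (R i) = bbF (xlo i) (xhi i) (ylo i) (yhi i) := by
    intro i
    rw [hR i]
    ext z
    simp only [bbF, mem_sdiff, bb_interior, mem_ofPred_eq]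
    refine and_congr_right fun hz => ?_
    obtain ⟨h1, h2, h3, h4⟩ := hz
    constructor
    · intro h
      by_contra hcon
      push Not at hcon
      exact h ⟨lt_of_le_of_ne h1 hcon.1.symm, lt_of_le_of_ne h2 hcon.2.1,
        lt_of_le_of_ne h3 hcon.2.2.1.symm, lt_of_le_of_ne h4 hcon.2.2.2⟩
    · rintro h ⟨g1, g2, g3, g4⟩
      rcases h with h | h | h | h <;> linarith
  have hcl : ∀ i, IsClosed (R i) := by
    intro i
    rw [hR i]
    have c0 := hc 0
    have c1 := hc 1
    exact (isClosed_le continuous_const c0).inter ((isClosed_le c0 continuous_const).inter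
      ((isClosed_le continuous_const c1).inter (isClosed_le c1 continuous_const)))
  have key := bb_induct R hcl hdisjR γ hγ (by
    intro i a b h0 hab h1 hp hq
    rw [hF i] at hp hq ⊢
    refine bb_local (K i) (hconn i) _ _ _ _ (hbox i) ?_ ?_ ?_ ?_ γ a b hab
      (hγ.mono (Icc_subset_Icc h0 h1))
      (fun τ hτ => havoid τ ⟨h0.trans hτ.1, hτ.2.trans h1⟩ i) hp hq
    · rw [hxlo]; exact (himg i 0).sInf_mem ((hne i).image _)
    · rw [hxhi]; exact (himg i 0).sSup_mem ((hne i).image _)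
    · rw [hylo]; exact (himg i 1).sInf_mem ((hne i).image _)
    · rw [hyhi]; exact (himg i 1).sSup_mem ((hne i).image _)) Finset.univ 0 1 le_rfl zero_le_one
    le_rfl (fun i h => hs i (hγ0 ▸ interior_subset h)) (fun i h => ht i (hγ1 ▸ interior_subset h))
    (fun _ _ i _ => Finset.mem_univ i)
  rw [hγ0, hγ1, hL, ← ofReal_mul (Real.sqrt_nonneg 2)] at key
  exact key
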